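/- Let c = c_n be the n-cycle s_{n−1}⋯s_2s_1. For 0 ≤ k ≤ n−1, e_n c^k = e_n b⁺(n−1, k) in ℂW. In particular, since b⁺(n−1,k) ∈ ℂW_{n−1}, one has E_n = e_n ℂW = e_n ℂW_{n−1}. -/

import Mathlib

open scoped Classical
open MonoidAlgebra Finset Equiv

noncomputable section

namespace DPRSym

variable (n : ℕ)

/-- The simple reflection `s_i` (1-based, `1 ≤ i ≤ n-1`) of the symmetric group
`S_n = Perm (Fin n)`: the transposition of the (0-based) points `i-1` and `i`. -/
def sgen (i : ℕ) : Equiv.Perm (Fin n) :=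
  if h : 0 < i ∧ i < n then Equiv.swap ⟨i - 1, by omega⟩ ⟨i, h.2⟩ else 1

/-- The Coxeter generating set `S = {s_1, …, s_{n-1}}` of `S_n`. -/
def Simples : Finset (Equiv.Perm (Fin n)) := (Finset.Icc 1 (n - 1)).image (sgen n)

/-- The Coxeter length of a permutation: the length of a shortest word in the
generators `S` expressing it. -/
def len (w : Equiv.Perm (Fin n)) : ℕ :=
  sInf {k | ∃ L : List (Equiv.Perm (Fin n)),
    (∀ x ∈ L, x ∈ Simples n) ∧ L.length = k ∧ L.prod = w}

/-- The `i`-cycle `c_i = s_{i-1} ⋯ s_2 s_1` (with `c_1 = 1`). -/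
def cgen (i : ℕ) : Equiv.Perm (Fin n) :=
  (((List.range (i - 1)).reverse).map (fun j => sgen n (j + 1))).prod

/-- The set `W^I` of minimal length left coset representatives of `W_I`,
computed inside the subset `H` (take `H = Set.univ` for the absolute case). -/
def minCoset (H : Set (Equiv.Perm (Fin n))) (I : Finset (Equiv.Perm (Fin n))) :
    Finset (Equiv.Perm (Fin n)) :=
  Finset.univ.filter (fun w => w ∈ H ∧ ∀ s ∈ I, len n w < len n (w * s))

/-- The element `x_I = ∑_{w ∈ W^I} w` of the group algebra. -/
def xRel (H : Set (Equiv.Perm (Fin n))) (I : Finset (Equiv.Perm (Fin n))) :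
    MonoidAlgebra ℂ (Equiv.Perm (Fin n)) :=
  ∑ w ∈ minCoset n H I, of ℂ (Equiv.Perm (Fin n)) w

/-- `w(Δ_J) ⊆ Δ_D`: for every `s ∈ J`, `wsw⁻¹ ∈ D` and `ℓ(ws) = ℓ(w) + 1`. -/
def Takes (D : Finset (Equiv.Perm (Fin n))) (w : Equiv.Perm (Fin n))
    (J : Finset (Equiv.Perm (Fin n))) : Prop :=
  ∀ s ∈ J, w * s * w⁻¹ ∈ D ∧ len n (w * s) = len n w + 1

/-- `ᵂJ = wJw⁻¹`. -/
def conjF (w : Equiv.Perm (Fin n)) (J : Finset (Equiv.Perm (Fin n))) :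
    Finset (Equiv.Perm (Fin n)) :=
  J.image (fun s => w * s * w⁻¹)

/-- The coefficient `m_{JK}` (for `σ ≡ 1`: the number of `w ∈ W^K` with
`w(Δ_J) ⊆ Δ`), relative to the pair `(H, D)`. -/
def mC (H : Set (Equiv.Perm (Fin n))) (D : Finset (Equiv.Perm (Fin n)))
    (J K : Finset (Equiv.Perm (Fin n))) : ℕ :=
  if J ⊆ K then ((minCoset n H K).filter (fun w => Takes n D w J)).card else 0

/-- The family `(e_J)` of BBHT quasi-idempotents for `σ ≡ 1`, relative to `(H, D)`:
the unique solution of the triangular system `x_K = ∑_{J ⊆ K} m_{JK} e_J`, `K ⊆ D`. -/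
def IsBBHT (H : Set (Equiv.Perm (Fin n))) (D : Finset (Equiv.Perm (Fin n)))
    (e : Finset (Equiv.Perm (Fin n)) → MonoidAlgebra ℂ (Equiv.Perm (Fin n))) : Prop :=
  ∀ K ∈ D.powerset, xRel n H K = ∑ J ∈ K.powerset, (mC n H D J K : ℂ) • e J

/-- `b⁺(m, k)`: the coefficient of `t^k` in `(1 - c_1 t)(1 - c_2 t) ⋯ (1 - c_m t)`,
a polynomial with coefficients in the group algebra `ℂ S_n`. -/
def bplus (m k : ℕ) : MonoidAlgebra ℂ (Equiv.Perm (Fin n)) :=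
  (((List.range m).map (fun i =>
      1 - Polynomial.C (of ℂ (Equiv.Perm (Fin n)) (cgen n (i + 1))) * Polynomial.X)).prod).coeff k

/-- The transposition of the 0-based points `a` and `b` (junk value `1` if out of range). -/
def fswap (a b : ℕ) : Equiv.Perm (Fin n) :=
  if h : a < n ∧ b < n then Equiv.swap ⟨a, h.1⟩ ⟨b, h.2⟩ else 1

/-- The simple reflection exchanging the points `i` and `i + 1`. -/
def stp {m : ℕ} (i : Fin m) : Perm (Fin (m + 1)) := swap i.castSucc i.succ

/-- The inversions of `w`. -/
def invs {m : ℕ} (w : Perm (Fin (m + 1))) : Finset (Fin (m + 1) × Fin (m + 1)) :=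
  univ.filter fun p => p.1 < p.2 ∧ w p.2 < w p.1

lemma mem_invs {m : ℕ} {w : Perm (Fin (m + 1))} {p : Fin (m + 1) × Fin (m + 1)} :
    p ∈ invs w ↔ p.1 < p.2 ∧ w p.2 < w p.1 := by
  rw [invs, mem_filter]
  exact and_iff_right (mem_univ p)

lemma invs_one {m : ℕ} : invs (1 : Perm (Fin (m + 1))) = ∅ := by
  ext p
  simpa [mem_invs] using fun h : p.1 < p.2 => h.le

lemma sgen_succ {m : ℕ} (i : Fin m) : sgen (m + 1) (i + 1) = stp i := by
  unfold sgen stp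
  rw [dif_pos ⟨by omega, by omega⟩]
  rfl

lemma mem_Simples {m : ℕ} {x : Perm (Fin (m + 1))} :
    x ∈ Simples (m + 1) ↔ ∃ i : Fin m, stp i = x := by
  simp only [Simples, mem_image, mem_Icc]
  constructor
  · rintro ⟨j, ⟨h1, h2⟩, rfl⟩
    refine ⟨⟨j - 1, by omega⟩, ?_⟩
    rw [← sgen_succ]
    congr 1
    simp only
    omega
  · rintro ⟨i, rfl⟩
    exact ⟨i + 1, ⟨by omega, by omega⟩, sgen_succ i⟩

lemma stp_mul_stp {m : ℕ} (i : Fin m) : stp i * stp i = 1 := swap_mul_self _ _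

lemma stp_castSucc {m : ℕ} (i : Fin m) : stp i i.castSucc = i.succ := swap_apply_left _ _

lemma stp_succ {m : ℕ} (i : Fin m) : stp i i.succ = i.castSucc := swap_apply_right _ _

lemma stp_stp {m : ℕ} (i : Fin m) (a : Fin (m + 1)) : stp i (stp i a) = a := swap_apply_self _ _ _

lemma stp_lt_stp {m : ℕ} (i : Fin m) {a b : Fin (m + 1)} (h : a < b)
    (hne : ¬ (a = i.castSucc ∧ b = i.succ)) : stp i a < stp i b := by
  unfold stp
  simp only [swap_apply_def]
  simp only [Fin.ext_iff, Fin.lt_def, Fin.val_castSucc, Fin.val_succ] at *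
  split_ifs <;> simp <;> omega

lemma card_invs_mul_stp {m : ℕ} (w : Perm (Fin (m + 1))) (i : Fin m) (h : w i.castSucc < w i.succ) :
    (invs (w * stp i)).card = (invs w).card + 1 := by
  have : invs (w * stp i) =
      insert (i.castSucc, i.succ) ((invs w).map (Equiv.prodCongr (stp i) (stp i)).toEmbedding) := by
    ext ⟨a, b⟩
    simp only [mem_invs, mem_insert, mem_map, Perm.mul_apply,
      Equiv.coe_toEmbedding, Prod.exists, Prod.mk.injEq, Equiv.prodCongr_apply, Prod.map_apply]
    constructor
    · rintro ⟨hab, hw⟩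
      by_cases hne : a = i.castSucc ∧ b = i.succ
      · exact Or.inl hne
      · exact Or.inr ⟨stp i a, stp i b, ⟨stp_lt_stp i hab hne, hw⟩, stp_stp _ _, stp_stp _ _⟩
    · rintro (⟨rfl, rfl⟩ | ⟨x, y, ⟨hxy, hw⟩, rfl, rfl⟩)
      · rw [stp_castSucc, stp_succ]
        exact ⟨Fin.castSucc_lt_succ, h⟩
      · simp only [stp_stp]
        refine ⟨stp_lt_stp i hxy ?_, hw⟩
        rintro ⟨rfl, rfl⟩
        exact absurd h hw.not_gt
  rw [this, card_insert_of_notMem, card_map]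
  simp only [mem_invs, mem_map, Equiv.coe_toEmbedding, Prod.exists,
    Equiv.prodCongr_apply, Prod.map_apply, Prod.mk.injEq, not_exists, not_and]
  rintro x y ⟨hxy, -⟩ h1 h2
  have h3 : x = i.succ := by rw [← stp_stp i x, h1, stp_castSucc]
  have h4 : y = i.castSucc := by rw [← stp_stp i y, h2, stp_succ]
  subst h3 h4
  exact absurd hxy Fin.castSucc_lt_succ.not_gt

lemma card_invs_mul_stp_of_gt {m : ℕ} (w : Perm (Fin (m + 1))) (i : Fin m)
    (h : w i.succ < w i.castSucc) : (invs w).card = (invs (w * stp i)).card + 1 := by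
  have := card_invs_mul_stp (w * stp i) i (by simpa [stp_castSucc, stp_succ] using h)
  rwa [mul_assoc, stp_mul_stp, mul_one] at this

lemma lt_or_gt_step {m : ℕ} (w : Perm (Fin (m + 1))) (i : Fin m) :
    w i.castSucc < w i.succ ∨ w i.succ < w i.castSucc :=
  lt_or_gt_of_ne (w.injective.ne Fin.castSucc_lt_succ.ne)

lemma eq_one_of_forall_lt {m : ℕ} {w : Perm (Fin (m + 1))}
    (h : ∀ i : Fin m, w i.castSucc < w i.succ) : w = 1 := by
  have hs : StrictMono w := Fin.strictMono_iff_lt_succ.2 h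
  have := Subsingleton.elim (hs.orderIsoOfSurjective w w.surjective) (OrderIso.refl (Fin (m + 1)))
  ext a
  simpa using congrArg (fun f : Fin (m + 1) ≃o Fin (m + 1) => (f a : ℕ)) this

lemma len_eq {m : ℕ} (w : Perm (Fin (m + 1))) : len (m + 1) w = (invs w).card := by
  have hword : ∀ k : ℕ, ∀ w : Perm (Fin (m + 1)), (invs w).card = k →
      ∃ L : List (Perm (Fin (m + 1))),
        (∀ x ∈ L, x ∈ Simples (m + 1)) ∧ L.length = k ∧ L.prod = w := by
    intro k
    induction k with
    | zero =>
      intro w hw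
      refine ⟨[], by simp, rfl, ?_⟩
      rw [List.prod_nil, eq_comm]
      refine eq_one_of_forall_lt fun i => (lt_or_gt_step w i).resolve_right fun h => ?_
      have := card_invs_mul_stp_of_gt w i h
      omega
    | succ k ih =>
      intro w hw
      obtain ⟨i, hi⟩ : ∃ i : Fin m, w i.succ < w i.castSucc := by
        by_contra! hcon
        have : w = 1 :=
          eq_one_of_forall_lt fun i => (lt_or_gt_step w i).resolve_right (hcon i).not_gt
        subst this
        simp [invs_one] at hw
      obtain ⟨L, h1, h2, h3⟩ := ih (w * stp i) (by have := card_invs_mul_stp_of_gt w i hi; omega)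
      refine ⟨L ++ [stp i], ?_, by simp [h2], ?_⟩
      · intro x hx
        rcases List.mem_append.1 hx with hx | hx
        · exact h1 x hx
        · exact mem_Simples.2 ⟨i, (List.mem_singleton.1 hx).symm⟩
      · rw [List.prod_append, h3, List.prod_singleton, mul_assoc, stp_mul_stp, mul_one]
  have hle : ∀ L : List (Perm (Fin (m + 1))), (∀ x ∈ L, x ∈ Simples (m + 1)) →
      (invs L.prod).card ≤ L.length := by
    intro L
    induction L using List.reverseRecOn with
    | nil =>
      intro _
      simp [invs_one]
    | append_singleton L x ih =>
      intro hL
      have := ih fun y hy => hL y (by simp [hy])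
      obtain ⟨i, rfl⟩ := mem_Simples.1 (hL x (by simp))
      rw [List.prod_append, List.prod_singleton, List.length_append, List.length_singleton]
      rcases lt_or_gt_step L.prod i with h | h
      · have := card_invs_mul_stp _ i h
        omega
      · have := card_invs_mul_stp_of_gt _ i h
        omega
  apply le_antisymm
  · exact Nat.sInf_le (hword _ w rfl)
  · obtain ⟨L, h1, h2, h3⟩ := Nat.sInf_mem (⟨_, hword _ w rfl⟩ :
      {k | ∃ L : List (Perm (Fin (m + 1))),
      (∀ x ∈ L, x ∈ Simples (m + 1)) ∧ L.length = k ∧ L.prod = w}.Nonempty)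
    have := hle L h1
    rw [h3, h2] at this
    exact this

lemma len_lt_len_mul_stp {m : ℕ} (w : Perm (Fin (m + 1))) (i : Fin m) :
    len (m + 1) w < len (m + 1) (w * stp i) ↔ w i.castSucc < w i.succ := by
  rw [len_eq, len_eq]
  rcases lt_or_gt_step w i with h | h
  · have := card_invs_mul_stp _ i h
    exact ⟨fun _ => h, fun _ => by omega⟩
  · have := card_invs_mul_stp_of_gt _ i h
    exact ⟨fun _ => by omega, fun h' => absurd h' h.not_gt⟩

lemma conj_mem_and_len_iff {m : ℕ} (w : Perm (Fin (m + 1))) (i : Fin m) :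
    (w * stp i * w⁻¹ ∈ Simples (m + 1) ∧ len (m + 1) (w * stp i) = len (m + 1) w + 1) ↔
      (w i.succ : ℕ) = w i.castSucc + 1 := by
  have hconj : w * stp i * w⁻¹ = swap (w i.castSucc) (w i.succ) := (swap_apply_apply _ _ _).symm
  rw [hconj, mem_Simples]
  constructor
  · rintro ⟨⟨j, hj⟩, hl⟩
    have hlt : w i.castSucc < w i.succ := by
      rw [← len_lt_len_mul_stp]
      omega
    have h1 := congrArg (fun f : Perm (Fin (m + 1)) => (f j.castSucc : ℕ)) hj
    simp only [stp_castSucc, Fin.val_succ] at h1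
    rw [swap_apply_def] at h1
    simp only [Fin.ext_iff, Fin.lt_def, Fin.val_castSucc] at h1 hlt
    split_ifs at h1 <;> (try simp only [Fin.val_castSucc] at *) <;> omega
  · intro h
    refine ⟨⟨⟨w i.castSucc, by omega⟩, ?_⟩, ?_⟩
    · unfold stp
      congr 1
      ext
      simp [h]
    · have hlt : w i.castSucc < w i.succ := by
        rw [Fin.lt_def]
        omega
      rw [len_eq, len_eq, card_invs_mul_stp _ _ hlt]

/-- A monotone surjection collapsing exactly the steps in `J`. -/
structure IsCollapse {m r : ℕ} (J : Finset (Fin m)) (blk : Fin (m + 1) → Fin (r + 1)) : Prop where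
  surj : Function.Surjective blk
  mono : Monotone blk
  eq_of_mem : ∀ i ∈ J, blk i.castSucc = blk i.succ
  succ_of_notMem : ∀ i ∉ J, (blk i.succ : ℕ) = blk i.castSucc + 1

lemma exists_isCollapse {m : ℕ} (J : Finset (Fin m)) :
    ∃ blk : Fin (m + 1) → Fin (Jᶜ.card + 1), IsCollapse J blk := by
  let c : Fin (m + 1) → ℕ := fun i => (Jᶜ.filter fun j => j.castSucc < i).card
  have hc : ∀ i, c i < Jᶜ.card + 1 := fun i => Nat.lt_succ_of_le (card_filter_le _ _)
  have h1 : ∀ i ∈ J, c i.castSucc = c i.succ := by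
    intro i hi
    refine congrArg card (filter_congr fun j hj => ?_)
    have : j ≠ i := by
      rintro rfl
      exact mem_compl.1 hj hi
    simp only [Fin.lt_def, Fin.val_castSucc, Fin.val_succ, ne_eq, Fin.ext_iff] at *
    omega
  have h2 : ∀ i ∉ J, c i.succ = c i.castSucc + 1 := by
    intro i hi
    have : (Jᶜ.filter fun j => j.castSucc < i.succ)
        = insert i (Jᶜ.filter fun j => j.castSucc < i.castSucc) := by
      ext j
      simp only [mem_filter, mem_insert, mem_compl, Fin.lt_def, Fin.val_castSucc, Fin.val_succ]
      constructor
      · rintro ⟨hj, hlt⟩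
        by_cases hji : j = i
        · exact Or.inl hji
        · refine Or.inr ⟨hj, ?_⟩
          rw [Fin.ext_iff] at hji
          omega
      · rintro (rfl | ⟨hj, hlt⟩)
        · exact ⟨hi, by omega⟩
        · exact ⟨hj, by omega⟩
    show card _ = card _ + 1
    rw [this, card_insert_of_notMem]
    simp
  have h3 : ∀ i, ∀ v ≤ c i, ∃ i', c i' = v := by
    intro i
    induction i using Fin.induction with
    | zero =>
      intro v hv
      have : c 0 = 0 := by
        show card _ = 0
        simp
      exact ⟨0, by omega⟩
    | succ i ih =>
      intro v hv
      by_cases hi : i ∈ J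
      · exact ih v (by rwa [h1 i hi])
      · rcases hv.lt_or_eq with h | h
        · exact ih v (by rw [h2 i hi] at h; omega)
        · exact ⟨_, h.symm⟩
  refine ⟨fun i => ⟨c i, hc i⟩, ?_, ?_, ?_, h2⟩
  · intro v
    have hlast : c (Fin.last m) = Jᶜ.card := by
      show card _ = _
      rw [filter_true_of_mem]
      intro j _
      exact Fin.castSucc_lt_last j
    obtain ⟨i, hi⟩ := h3 (Fin.last m) v (by rw [hlast]; omega)
    exact ⟨i, Fin.ext hi⟩
  · intro a b hab
    rw [Fin.le_def]
    exact card_le_card fun j hj => by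
      rw [mem_filter] at hj ⊢
      exact ⟨hj.1, hj.2.trans_le hab⟩
  · exact fun i hi => Fin.ext (h1 i hi)

namespace IsCollapse

variable {m r : ℕ} {J : Finset (Fin m)} {blk : Fin (m + 1) → Fin (r + 1)}

lemma mem_of_eq (hb : IsCollapse J blk) {i : Fin m} (h : blk i.castSucc = blk i.succ) : i ∈ J := by
  by_contra hi
  have := hb.succ_of_notMem i hi
  rw [h] at this
  omega

lemma apply_eq_of_eq {X : Type*} (hb : IsCollapse J blk) {h : Fin (m + 1) → X}
    (hh : ∀ i ∈ J, h i.castSucc = h i.succ) {a b : Fin (m + 1)} (hab : blk a = blk b) :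
    h a = h b := by
  have key : ∀ b a, a ≤ b → blk a = blk b → h a = h b := by
    intro b
    induction b using Fin.induction with
    | zero =>
      intro a ha _
      rw [Fin.le_zero_iff.1 ha]
    | succ j ih =>
      intro a ha hab
      rcases ha.lt_or_eq with hlt | rfl
      · have hle : a ≤ j.castSucc := Fin.le_castSucc_iff.2 hlt
        have h1 := hb.mono hle
        have h2 := hb.mono (Fin.castSucc_lt_succ (i := j)).le
        have h3 : blk a = blk j.castSucc := le_antisymm h1 (hab ▸ h2)
        rw [ih a hle h3]
        exact hh j (hb.mem_of_eq (h3 ▸ hab))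
      · rfl
  rcases le_total a b with hle | hle
  · exact key b a hle hab
  · exact (key a b hle hab.symm).symm

lemma forall_step_iff (hb : IsCollapse J blk) (R : Fin (r + 1) → Fin (r + 1) → Prop) :
    (∀ x : Fin r, R x.castSucc x.succ) ↔ ∀ i ∉ J, R (blk i.castSucc) (blk i.succ) := by
  constructor
  · intro h i hi
    have hs := hb.succ_of_notMem i hi
    have h1 : blk i.castSucc = Fin.castSucc (⟨blk i.castSucc, by omega⟩ : Fin r) := rfl
    have h2 : blk i.succ = Fin.succ (⟨blk i.castSucc, by omega⟩ : Fin r) := Fin.ext hs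
    rw [h1, h2]
    exact h _
  · intro h x
    have key : ∀ b, x.succ ≤ blk b → R x.castSucc x.succ := by
      intro b
      induction b using Fin.induction with
      | zero =>
        intro hx
        obtain ⟨a, ha⟩ := hb.surj 0
        have := (hx.trans (hb.mono (Fin.zero_le a))).trans_eq ha
        simp at this
      | succ j ih =>
        intro hx
        by_cases hj : x.succ ≤ blk j.castSucc
        · exact ih hj
        · have hJ : j ∉ J := fun hJ => hj (by rwa [hb.eq_of_mem j hJ])
          have hs := hb.succ_of_notMem j hJ
          simp only [Fin.le_def, Fin.val_succ] at hx hj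
          have h1 : x.castSucc = blk j.castSucc := Fin.ext (by simp only [Fin.val_castSucc]; omega)
          have h2 : x.succ = blk j.succ := Fin.ext (by simp only [Fin.val_succ]; omega)
          rw [h1, h2]
          exact h j hJ
    obtain ⟨b, hb'⟩ := hb.surj x.succ
    exact key b hb'.ge

/-- Functions constant along the collapsed steps correspond to functions on the quotient. -/
lemma card_filter_comp {N : ℕ} (hb : IsCollapse J blk)
    (R : Fin (r + 1) → Fin (r + 1) → Fin N → Fin N → Prop) :
    (univ.filter fun h : Fin (m + 1) → Fin N => (∀ i ∈ J, h i.castSucc = h i.succ) ∧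
      ∀ i ∉ J, R (blk i.castSucc) (blk i.succ) (h i.castSucc) (h i.succ)).card =
    (univ.filter fun g : Fin (r + 1) → Fin N =>
      ∀ x : Fin r, R x.castSucc x.succ (g x.castSucc) (g x.succ)).card := by
  rw [← card_image_of_injective _ (hb.surj.injective_comp_right (γ := Fin N))]
  congr 1
  ext h
  simp only [mem_filter, mem_univ, true_and, mem_image]
  constructor
  · rintro ⟨h1, h2⟩
    have hfac : (h ∘ Function.surjInv hb.surj) ∘ blk = h := by
      funext a
      exact hb.apply_eq_of_eq h1 (Function.surjInv_eq hb.surj _)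
    refine ⟨h ∘ Function.surjInv hb.surj, ?_, hfac⟩
    rw [hb.forall_step_iff fun x y =>
      R x y ((h ∘ Function.surjInv hb.surj) x) ((h ∘ Function.surjInv hb.surj) y)]
    intro i hi
    have e := fun a => congrFun hfac a
    simp only [Function.comp_apply] at e ⊢
    rw [e, e]
    exact h2 i hi
  · rintro ⟨g, hg, rfl⟩
    rw [hb.forall_step_iff fun x y => R x y (g x) (g y)] at hg
    exact ⟨fun i hi => congrArg g (hb.eq_of_mem i hi), hg⟩

end IsCollapse

lemma card_filter_strictMono (r N : ℕ) :
    (univ.filter fun g : Fin (r + 1) → Fin N => ∀ x : Fin r, g x.castSucc < g x.succ).card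
      = N.choose (r + 1) := by
  rw [← Fintype.card_subtype,
    Fintype.card_congr (Equiv.subtypeEquivRight fun g => Fin.strictMono_iff_lt_succ.symm)]
  let e : {g : Fin (r + 1) → Fin N // StrictMono g} ≃ (Fin (r + 1) ↪o Fin N) :=
    { toFun := fun g => OrderEmbedding.ofStrictMono g.1 g.2
      invFun := fun f => ⟨f, f.strictMono⟩
      left_inv := fun _ => rfl
      right_inv := fun _ => by ext; rfl }
  rw [← Nat.card_eq_fintype_card, Nat.card_congr (e.trans Set.powersetCard.ofFinEmbEquiv),
    Set.powersetCard.card, Nat.card_eq_fintype_card, Fintype.card_fin]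

lemma card_filter_steps {m : ℕ} (N : ℕ) (J : Finset (Fin m)) :
    (univ.filter fun h : Fin (m + 1) → Fin N => (∀ i ∈ J, h i.castSucc = h i.succ) ∧
      ∀ i ∉ J, h i.castSucc < h i.succ).card = N.choose (Jᶜ.card + 1) := by
  obtain ⟨blk, hb⟩ := exists_isCollapse J
  rw [← card_filter_strictMono]
  convert hb.card_filter_comp (N := N) fun _ _ a b => a < b

lemma card_filter_chain {m : ℕ} (N : ℕ) (J U : Finset (Fin m)) :
    (univ.filter fun h : Fin (m + 1) → Fin N => (∀ i ∈ J, h i.castSucc = h i.succ) ∧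
      ∀ i, h i.castSucc < h i.succ ∨ (h i.castSucc = h i.succ ∧ i ∈ U)).card =
    ∑ K ∈ univ.filter (fun K : Finset (Fin m) => J ⊆ K ∧ K ⊆ U), N.choose (Kᶜ.card + 1) := by
  rw [card_eq_sum_card_fiberwise
    (f := fun h : Fin (m + 1) → Fin N => univ.filter fun i : Fin m => h i.castSucc = h i.succ)
    (t := univ.filter (fun K : Finset (Fin m) => J ⊆ K ∧ K ⊆ U))]
  · refine sum_congr rfl fun K hK => ?_
    rw [mem_filter] at hK
    rw [← card_filter_steps, filter_filter]
    congr 1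
    ext h
    simp only [mem_filter, mem_univ, true_and]
    constructor
    · rintro ⟨⟨h1, h2⟩, rfl⟩
      simp only [mem_filter, mem_univ, true_and]
      exact ⟨fun i => id, fun i hi => (h2 i).resolve_right fun h => hi h.1⟩
    · rintro ⟨h1, h2⟩
      refine ⟨⟨fun i hi => h1 i (hK.2.1 hi), fun i => ?_⟩, ?_⟩
      · by_cases hi : i ∈ K
        · exact Or.inr ⟨h1 i hi, hK.2.2 hi⟩
        · exact Or.inl (h2 i hi)
      · ext i
        simp only [mem_filter, mem_univ, true_and]
        exact ⟨fun h => by_contra fun hi => (h2 i hi).ne h, h1 i⟩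
  · intro h hh
    simp only [coe_filter, mem_univ, true_and, Set.mem_ofPred_eq] at hh ⊢
    refine ⟨fun i hi => by simpa using hh.1 i hi, fun i hi => ?_⟩
    simp only [mem_filter, mem_univ, true_and] at hi
    exact ((hh.2 i).resolve_left (by simp [hi])).2

lemma sort_inv_lt_iff {n : ℕ} {α : Type*} [LinearOrder α] (f : Fin n → α) (a b : Fin n) :
    (Tuple.sort f)⁻¹ a < (Tuple.sort f)⁻¹ b ↔ f a < f b ∨ (f a = f b ∧ a < b) := by
  obtain ⟨h1, h2⟩ := Tuple.eq_sort_iff.1 (rfl : Tuple.sort f = Tuple.sort f)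
  have key : ∀ a b, (Tuple.sort f)⁻¹ a < (Tuple.sort f)⁻¹ b → f a < f b ∨ (f a = f b ∧ a < b) := by
    intro a b h
    have h3 := h1 h.le
    have h4 := h2 _ _ h
    simp only [Function.comp_apply, ← Perm.mul_apply, mul_inv_cancel, Perm.one_apply] at h3 h4
    rcases h3.lt_or_eq with h5 | h5
    · exact Or.inl h5
    · exact Or.inr ⟨h5, h4 h5⟩
  refine ⟨key a b, fun h => ?_⟩
  by_contra hcon
  rcases (not_lt.1 hcon).lt_or_eq with h3 | h3
  · rcases key b a h3 with h4 | ⟨h4, h5⟩ <;> rcases h with h6 | ⟨h6, h7⟩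
    · exact lt_asymm h4 h6
    · exact h4.ne h6.symm
    · exact h6.ne h4.symm
    · exact lt_asymm h5 h7
  · have := (Tuple.sort f)⁻¹.injective h3
    subst this
    simp at h

/-- The ascents of `w`. -/
def ascents {m : ℕ} (w : Perm (Fin (m + 1))) : Finset (Fin m) :=
  univ.filter fun i => w i.castSucc < w i.succ

lemma mem_ascents {m : ℕ} {w : Perm (Fin (m + 1))} {i : Fin m} :
    i ∈ ascents w ↔ w i.castSucc < w i.succ := by
  rw [ascents, mem_filter]
  exact and_iff_right (mem_univ i)

lemma card_filter_sort {m : ℕ} (N : ℕ) (w : Perm (Fin (m + 1))) (S : Fin m → Prop → Prop) :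
    (univ.filter fun f : Fin (m + 1) → Fin N =>
      ∀ i, S i (i ∈ ascents ((Tuple.sort f)⁻¹ * w))).card =
    (univ.filter fun h : Fin (m + 1) → Fin N =>
      ∀ i, S i (h i.castSucc < h i.succ ∨ (h i.castSucc = h i.succ ∧ i ∈ ascents w))).card := by
  simp only [mem_ascents, Perm.mul_apply, sort_inv_lt_iff]
  rw [← card_image_of_injective _ (w.surjective.injective_comp_right (γ := Fin N))]
  congr 1
  ext h
  simp only [mem_filter, mem_univ, true_and, mem_image]
  constructor
  · rintro ⟨f, hf, rfl⟩
    exact hf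
  · intro hh
    refine ⟨h ∘ w.symm, ?_, ?_⟩
    · simpa using hh
    · funext a
      simp

lemma sort_eq_iff {m N : ℕ} (f : Fin (m + 1) → Fin N) (w : Perm (Fin (m + 1))) :
    Tuple.sort f = w ↔ ∀ i, i ∈ ascents ((Tuple.sort f)⁻¹ * w) := by
  simp only [mem_ascents]
  refine ⟨?_, fun h => ?_⟩
  · rintro rfl i
    simp
  · exact inv_mul_eq_one.1 (eq_one_of_forall_lt h)

lemma card_sort_eq_chain {m : ℕ} (N : ℕ) (w : Perm (Fin (m + 1))) :
    (univ.filter fun f : Fin (m + 1) → Fin N => Tuple.sort f = w).card =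
    (univ.filter fun h : Fin (m + 1) → Fin N =>
      ∀ i, h i.castSucc < h i.succ ∨ (h i.castSucc = h i.succ ∧ i ∈ ascents w)).card := by
  simp only [sort_eq_iff]
  convert card_filter_sort N w fun _ p => p

lemma card_chain {m : ℕ} (N : ℕ) (U : Finset (Fin m)) :
    (univ.filter fun h : Fin (m + 1) → Fin N =>
      ∀ i, h i.castSucc < h i.succ ∨ (h i.castSucc = h i.succ ∧ i ∈ U)).card =
    ∑ K ∈ U.powerset, N.choose (Kᶜ.card + 1) := by
  have := card_filter_chain N ∅ U
  simp only [notMem_empty, false_imp_iff, implies_true, true_and, empty_subset] at this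
  rw [this]
  refine sum_congr ?_ fun _ _ => rfl
  ext K
  simp

open Polynomial in
/-- The binomial polynomial `X.choose l`. -/
def binomPoly (l : ℕ) : ℂ[X] := Polynomial.C ((l.factorial : ℂ)⁻¹) * descPochhammer ℂ l

lemma eval_binomPoly (l N : ℕ) : (binomPoly l).eval (N : ℂ) = (N.choose l : ℂ) := by
  have : (l.factorial : ℂ) ≠ 0 := by exact_mod_cast l.factorial_ne_zero
  rw [binomPoly, Polynomial.eval_mul, Polynomial.eval_C, descPochhammer_eval_eq_descFactorial,
    Nat.descFactorial_eq_factorial_mul_choose]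
  push_cast
  field_simp

lemma poly_ext {P Q : Polynomial ℂ} (h : ∀ N : ℕ, P.eval (N : ℂ) = Q.eval (N : ℂ)) : P = Q := by
  refine Polynomial.eq_of_infinite_eval_eq P Q ?_
  refine (Set.infinite_range_of_injective (Nat.cast_injective (R := ℂ))).mono ?_
  rintro _ ⟨N, rfl⟩
  exact h N

/-- The polynomial in `N` counting the functions to `Fin N` with given weak steps `U`. -/
def chainPoly {m : ℕ} (U : Finset (Fin m)) : Polynomial ℂ :=
  ∑ K ∈ U.powerset, binomPoly (Kᶜ.card + 1)

lemma eval_chainPoly {m : ℕ} (U : Finset (Fin m)) (N : ℕ) :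
    (chainPoly U).eval (N : ℂ) = ((univ.filter fun h : Fin (m + 1) → Fin N =>
      ∀ i, h i.castSucc < h i.succ ∨ (h i.castSucc = h i.succ ∧ i ∈ U)).card : ℂ) := by
  rw [card_chain, chainPoly, Polynomial.eval_finsetSum]
  push_cast
  exact sum_congr rfl fun K _ => eval_binomPoly _ _

lemma coeff_zero_chainPoly {m : ℕ} (U : Finset (Fin m)) : (chainPoly U).coeff 0 = 0 := by
  rw [Polynomial.coeff_zero_eq_eval_zero]
  have := eval_chainPoly U 0
  rw [Nat.cast_zero] at this
  rw [this, Nat.cast_eq_zero, card_eq_zero, filter_eq_empty_iff]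
  exact fun h => (h 0).elim0

lemma card_rev_chain {m : ℕ} (N : ℕ) (U : Finset (Fin m)) :
    (univ.filter fun h : Fin (m + 1) → Fin N =>
      ∀ i, ¬ (h i.castSucc < h i.succ ∨ (h i.castSucc = h i.succ ∧ i ∈ U))).card =
    (univ.filter fun h : Fin (m + 1) → Fin N =>
      ∀ i, h i.castSucc < h i.succ ∨ (h i.castSucc = h i.succ ∧ i ∈ Uᶜ)).card := by
  rw [← card_image_of_injective _ (Fin.rev_injective.comp_left (α := Fin (m + 1)))]
  congr 1
  ext h
  simp only [mem_filter, mem_univ, true_and, mem_image, mem_compl]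
  constructor
  · rintro ⟨g, hg, rfl⟩ i
    have := hg i
    simp only [Function.comp_apply, Fin.rev_lt_rev, Fin.rev_inj]
    by_cases hi : i ∈ U <;> grind
  · intro hh
    refine ⟨Fin.rev ∘ h, fun i => ?_, ?_⟩
    · have := hh i
      simp only [Function.comp_apply, Fin.rev_lt_rev, Fin.rev_inj]
      by_cases hi : i ∈ U <;> grind
    · funext a
      simp

lemma card_filter_append {a b : ℕ} (N : ℕ) (R : Fin (a + 1 + b) → Fin N → Fin N → Prop) :
    (univ.filter fun h : Fin (a + 1 + b + 1) → Fin N =>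
      ∀ i : Fin (a + 1 + b), (i : ℕ) ≠ a → R i (h i.castSucc) (h i.succ)).card =
    (univ.filter fun g : Fin (a + 1) → Fin N =>
      ∀ i : Fin a, R ⟨i, by omega⟩ (g i.castSucc) (g i.succ)).card *
    (univ.filter fun g : Fin (b + 1) → Fin N =>
      ∀ i : Fin b, R ⟨a + 1 + i, by omega⟩ (g i.castSucc) (g i.succ)).card := by
  rw [← card_product]
  symm
  refine card_equiv (Fin.appendEquiv (a + 1) (b + 1)) ?_
  rintro ⟨g, g'⟩
  simp only [mem_product, mem_filter, mem_univ, true_and, Fin.appendEquiv, Equiv.coe_fn_mk]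
  have hl : ∀ (j : ℕ) (hj : j < a + 1), @Fin.append (a + 1) (b + 1) _ g g' ⟨j, by omega⟩ =
      g ⟨j, hj⟩ :=
    fun j hj => Fin.append_left g g' ⟨j, hj⟩
  have hr : ∀ (j : ℕ) (hj : j < b + 1), @Fin.append (a + 1) (b + 1) _ g g'
      ⟨a + 1 + j, by omega⟩ = g' ⟨j, hj⟩ :=
    fun j hj => Fin.append_right g g' ⟨j, hj⟩
  constructor
  · rintro ⟨h1, h2⟩ ⟨i, hi⟩ hia
    rcases Nat.lt_or_ge i a with hlt | hge
    · have := h1 ⟨i, hlt⟩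
      simp only [Fin.castSucc_mk, Fin.succ_mk] at this ⊢
      rwa [hl i (by omega), hl (i + 1) (by omega)]
    · obtain ⟨j, rfl⟩ : ∃ j, i = a + 1 + j := ⟨i - (a + 1), by simp only [ne_eq] at hia; omega⟩
      have := h2 ⟨j, by omega⟩
      simp only [Fin.castSucc_mk, Fin.succ_mk] at this ⊢
      have e := hr (j + 1) (by omega)
      simp only [← add_assoc] at e
      rwa [hr j (by omega), e]
  · intro h
    constructor
    · rintro ⟨i, hi⟩
      have := h ⟨i, by omega⟩ (by simp only [ne_eq]; omega)
      simp only [Fin.castSucc_mk, Fin.succ_mk] at this ⊢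
      rwa [hl i (by omega), hl (i + 1) (by omega)] at this
    · rintro ⟨j, hj⟩
      have := h ⟨a + 1 + j, by omega⟩ (by simp only [ne_eq]; omega)
      simp only [Fin.castSucc_mk, Fin.succ_mk] at this ⊢
      have e := hr (j + 1) (by omega)
      simp only [← add_assoc] at e
      rwa [hr j (by omega), e] at this

/-- The permutations decreasing on the first `k` positions and increasing on the others that fix
all points from `l` on. -/
def valleys (m l k : ℕ) : Finset (Perm (Fin (m + 1))) :=
  univ.filter fun y => (∀ j : Fin (m + 1), l ≤ j → y j = j) ∧
    ∀ i : Fin m, ((i : ℕ) + 1 < k → i ∉ ascents y) ∧ (k ≤ i → i ∈ ascents y)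

lemma mem_valleys {m l k : ℕ} {y : Perm (Fin (m + 1))} : y ∈ valleys m l k ↔
    (∀ j : Fin (m + 1), l ≤ j → y j = j) ∧
    ∀ i : Fin m, ((i : ℕ) + 1 < k → i ∉ ascents y) ∧ (k ≤ i → i ∈ ascents y) := by
  rw [valleys, mem_filter]
  exact and_iff_right (mem_univ y)

lemma sum_valleys_coeff_one {m k : ℕ} (hk : 1 ≤ k) (hkm : k ≤ m) (w : Perm (Fin (m + 1))) :
    ∑ y ∈ valleys m (m + 1) k, (chainPoly (ascents (w * y⁻¹))).coeff 1 = 0 := by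
  obtain ⟨a, rfl⟩ : ∃ a, k = a + 1 := ⟨k - 1, by omega⟩
  obtain ⟨b, rfl⟩ : ∃ b, m = a + 1 + b := ⟨m - (a + 1), by omega⟩
  have key : ∑ y ∈ valleys (a + 1 + b) (a + 1 + b + 1) (a + 1), chainPoly (ascents (w * y⁻¹)) =
      chainPoly (univ.filter fun i : Fin a => (⟨i, by omega⟩ : Fin (a + 1 + b)) ∈ ascents w)ᶜ *
      chainPoly (univ.filter fun i : Fin b =>
        (⟨a + 1 + i, by omega⟩ : Fin (a + 1 + b)) ∈ ascents w) := by
    refine poly_ext fun N => ?_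
    rw [Polynomial.eval_finsetSum, Polynomial.eval_mul, eval_chainPoly, eval_chainPoly,
      ← card_rev_chain]
    simp only [eval_chainPoly, ← card_sort_eq_chain]
    have h1 : ∑ y ∈ valleys (a + 1 + b) (a + 1 + b + 1) (a + 1),
        (univ.filter fun f : Fin (a + 1 + b + 1) → Fin N => Tuple.sort f = w * y⁻¹).card =
        (univ.filter fun f : Fin (a + 1 + b + 1) → Fin N =>
          ∀ i : Fin (a + 1 + b), (((i : ℕ) + 1 < a + 1 → i ∉ ascents ((Tuple.sort f)⁻¹ * w)) ∧
            (a + 1 ≤ i → i ∈ ascents ((Tuple.sort f)⁻¹ * w)))).card := by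
      rw [card_eq_sum_card_fiberwise (f := fun f : Fin (a + 1 + b + 1) → Fin N =>
        (Tuple.sort f)⁻¹ * w) (t := valleys (a + 1 + b) (a + 1 + b + 1) (a + 1))]
      · refine sum_congr rfl fun y hy => congrArg card ?_
        ext f
        simp only [mem_filter, mem_univ, true_and]
        constructor
        · intro hf
          have : (Tuple.sort f)⁻¹ * w = y := by rw [hf]; group
          rw [this]
          exact ⟨(mem_valleys.1 hy).2, rfl⟩
        · rintro ⟨-, rfl⟩
          group
      · intro f hf
        simp only [coe_filter, mem_univ, true_and, Set.mem_ofPred_eq, mem_coe] at hf ⊢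
        exact mem_valleys.2 ⟨fun j hj => absurd j.2 (by omega), hf⟩
    rw [← Nat.cast_sum, h1, ← Nat.cast_mul]
    congr 1
    refine Eq.trans (congrArg card ?_) ((card_filter_sort N w fun i p =>
      ((i : ℕ) + 1 < a + 1 → ¬ p) ∧ (a + 1 ≤ i → p)).trans ?_)
    · ext f
      simp only [mem_filter]
    have h2 := card_filter_append (a := a) (b := b) N fun i x y =>
      ((i : ℕ) + 1 < a + 1 → ¬ (x < y ∨ (x = y ∧ i ∈ ascents w))) ∧
        (a + 1 ≤ i → (x < y ∨ (x = y ∧ i ∈ ascents w)))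
    refine Eq.trans (congrArg card ?_) (h2.trans ?_)
    · ext h
      simp only [mem_filter, mem_univ, true_and]
      refine forall_congr' fun i => ⟨fun h _ => h, fun h => ?_⟩
      by_cases hi : (i : ℕ) = a
      · exact ⟨fun _ => by omega, fun _ => by omega⟩
      · exact h hi
    · congr 2
      · ext g
        simp only [mem_filter, mem_univ, true_and]
        refine forall_congr' fun i => ⟨fun h => h.1 (by simp), fun h => ⟨fun _ => h, fun h' => ?_⟩⟩
        omega
      · ext g
        simp only [mem_filter, mem_univ, true_and]
        refine forall_congr' fun i => ⟨fun h => h.2 (by simp), fun h => ⟨fun h' => ?_, fun _ => h⟩⟩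
        omega
  rw [← Polynomial.finsetSum_coeff, key, Polynomial.coeff_mul]
  simp [Finset.Nat.antidiagonal_succ, coeff_zero_chainPoly]

lemma perm_eq_of_lt_iff {m : ℕ} {w w' : Perm (Fin (m + 1))} (h : ∀ a b, w a < w b ↔ w' a < w' b) :
    w = w' := by
  symm
  refine mul_inv_eq_one.1 (eq_one_of_forall_lt fun i => ?_)
  rw [Perm.mul_apply, Perm.mul_apply, ← h]
  simp

/-- The permutations sending the steps in `J` to steps. -/
def stepPreserving {m : ℕ} (J : Finset (Fin m)) : Finset (Perm (Fin (m + 1))) :=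
  univ.filter fun w => ∀ i ∈ J, (w i.succ : ℕ) = w i.castSucc + 1

lemma mem_stepPreserving {m : ℕ} {J : Finset (Fin m)} {w : Perm (Fin (m + 1))} :
    w ∈ stepPreserving J ↔ ∀ i ∈ J, (w i.succ : ℕ) = w i.castSucc + 1 := by
  rw [stepPreserving, mem_filter]
  exact and_iff_right (mem_univ w)

/-- The permutation of the points permuting the blocks of `blk` according to `π`. -/
def inflate {m r : ℕ} (blk : Fin (m + 1) → Fin (r + 1)) (π : Perm (Fin (r + 1))) :
    Perm (Fin (m + 1)) := (Tuple.sort (π ∘ blk))⁻¹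

lemma inflate_lt_iff {m r : ℕ} (blk : Fin (m + 1) → Fin (r + 1)) (π : Perm (Fin (r + 1)))
    (a b : Fin (m + 1)) : inflate blk π a < inflate blk π b ↔
      π (blk a) < π (blk b) ∨ (blk a = blk b ∧ a < b) := by
  rw [inflate, sort_inv_lt_iff]
  simp

namespace IsCollapse

variable {m r : ℕ} {J : Finset (Fin m)} {blk : Fin (m + 1) → Fin (r + 1)}

lemma inflate_injective (hb : IsCollapse J blk) : Function.Injective (inflate blk) := by
  intro π π' h
  refine perm_eq_of_lt_iff fun x y => ?_
  obtain ⟨a, rfl⟩ := hb.surj x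
  obtain ⟨b, rfl⟩ := hb.surj y
  by_cases hab : blk a = blk b
  · simp [hab]
  · have h1 := inflate_lt_iff blk π a b
    have h2 := inflate_lt_iff blk π' a b
    simp only [hab, false_and, or_false] at h1 h2
    rw [← h1, ← h2, h]

lemma inflate_mem (hb : IsCollapse J blk) (π : Perm (Fin (r + 1))) :
    inflate blk π ∈ stepPreserving J := by
  rw [mem_stepPreserving]
  intro i hi
  have he := hb.eq_of_mem i hi
  have h1 : inflate blk π i.castSucc < inflate blk π i.succ :=
    (inflate_lt_iff _ _ _ _).2 (Or.inr ⟨he, Fin.castSucc_lt_succ⟩)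
  by_contra hne
  rw [Fin.lt_def] at h1
  obtain ⟨c, hc⟩ := (inflate blk π).surjective ⟨inflate blk π i.castSucc + 1, by omega⟩
  have h2 : inflate blk π i.castSucc < inflate blk π c := by
    rw [hc, Fin.lt_def]
    simp
  have h3 : inflate blk π c < inflate blk π i.succ := by
    rw [hc, Fin.lt_def]
    simp only
    omega
  rw [inflate_lt_iff] at h2 h3
  rw [he] at h2
  rcases h2 with h2 | ⟨h2, h2'⟩ <;> rcases h3 with h3 | ⟨h3, h3'⟩
  · exact lt_asymm h2 h3
  · rw [h3] at h2
    exact lt_irrefl _ h2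
  · rw [h2] at h3
    exact lt_irrefl _ h3
  · rw [Fin.lt_def] at h2' h3'
    simp only [Fin.val_castSucc, Fin.val_succ] at h2' h3'
    omega

lemma sub_eq (hb : IsCollapse J blk) {w : Perm (Fin (m + 1))} (hw : w ∈ stepPreserving J)
    {a b : Fin (m + 1)} (hab : blk a = blk b) : (w a : ℤ) - a = w b - b := by
  refine hb.apply_eq_of_eq (h := fun a : Fin (m + 1) => (w a : ℤ) - a) (fun i hi => ?_) hab
  simp only [mem_stepPreserving.1 hw i hi, Fin.val_castSucc, Fin.val_succ]
  push_cast
  ring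

lemma eq_of_between (hb : IsCollapse J blk) {w : Perm (Fin (m + 1))} (hw : w ∈ stepPreserving J)
    {a a' c : Fin (m + 1)} (ha : blk a = blk a') (h1 : w a ≤ w c) (h2 : w c ≤ w a') :
    blk c = blk a := by
  have h3 := hb.sub_eq hw ha
  rw [Fin.le_def] at h1 h2
  have hlt : (a : ℕ) + (w c - w a) < m + 1 := by omega
  have h4 : a ≤ ⟨(a : ℕ) + (w c - w a), hlt⟩ := by
    rw [Fin.le_def]
    simp
  have h5 : (⟨(a : ℕ) + (w c - w a), hlt⟩ : Fin (m + 1)) ≤ a' := by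
    rw [Fin.le_def]
    simp only
    omega
  have h6 : blk ⟨(a : ℕ) + (w c - w a), hlt⟩ = blk a :=
    le_antisymm ((hb.mono h5).trans ha.ge) (hb.mono h4)
  have h7 := hb.sub_eq hw h6
  simp only at h7
  have h8 : w ⟨(a : ℕ) + (w c - w a), hlt⟩ = w c := Fin.ext (by omega)
  rw [← h6, w.injective h8]

lemma lt_of_lt (hb : IsCollapse J blk) {w : Perm (Fin (m + 1))} (hw : w ∈ stepPreserving J)
    {a a' b b' : Fin (m + 1)} (ha : blk a = blk a') (hb' : blk b = blk b') (hab : blk a ≠ blk b)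
    (h : w a < w b) : w a' < w b' := by
  by_contra hcon
  rw [not_lt] at hcon
  rcases le_total (w b) (w a') with h1 | h1
  · exact hab (hb.eq_of_between hw ha h.le h1).symm
  · exact hab (ha.trans ((hb.eq_of_between hw hb'.symm hcon h1).trans hb'.symm))

lemma image_inflate (hb : IsCollapse J blk) : univ.image (inflate blk) = stepPreserving J := by
  ext w
  simp only [mem_image, mem_univ, true_and]
  constructor
  · rintro ⟨π, rfl⟩
    exact hb.inflate_mem π
  · intro hw
    have hrep := Function.surjInv_eq hb.surj
    set rep := Function.surjInv hb.surj
    have hinj : Function.Injective (w ∘ rep) :=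
      w.injective.comp (Function.injective_surjInv hb.surj)
    refine ⟨(Tuple.sort (w ∘ rep))⁻¹, perm_eq_of_lt_iff fun a b => ?_⟩
    rw [inflate_lt_iff, sort_inv_lt_iff]
    by_cases hab : blk a = blk b
    · have := hb.sub_eq hw hab
      simp only [hab, lt_self_iff_false, and_false, or_false, true_and, false_or]
      rw [Fin.lt_def, Fin.lt_def]
      omega
    · have hne : (w ∘ rep) (blk a) ≠ (w ∘ rep) (blk b) := hinj.ne hab
      simp only [hab, hne, false_and, or_false]
      have ha := hrep (blk a)
      have hb' := hrep (blk b)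
      exact ⟨hb.lt_of_lt hw ha hb' (by rwa [ha, hb']), hb.lt_of_lt hw ha.symm hb'.symm hab⟩

lemma card_filter_inflate (hb : IsCollapse J blk) (N : ℕ) (π : Perm (Fin (r + 1))) :
    (univ.filter fun h : Fin (m + 1) → Fin N => (∀ i ∈ J, h i.castSucc = h i.succ) ∧
      ∀ i, h i.castSucc < h i.succ ∨
        (h i.castSucc = h i.succ ∧ i ∈ ascents (inflate blk π))).card =
    (univ.filter fun g : Fin (r + 1) → Fin N => Tuple.sort g = π).card := by
  rw [card_sort_eq_chain]
  simp only [mem_ascents]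
  refine Eq.trans (congrArg card ?_) ((hb.card_filter_comp (N := N) fun x y a b =>
    a < b ∨ (a = b ∧ π x < π y)).trans (congrArg card ?_))
  · ext h
    simp only [mem_filter, mem_univ, true_and, inflate_lt_iff]
    refine and_congr_right fun hJ => forall_congr' fun i => ?_
    by_cases hi : i ∈ J
    · simp [hi, hJ i hi, hb.eq_of_mem i hi]
    · have : blk i.castSucc ≠ blk i.succ := fun h => hi (hb.mem_of_eq h)
      simp [hi, this]
  · ext g
    simp only [mem_filter]

end IsCollapse

lemma sum_card_stepPreserving {m : ℕ} (J : Finset (Fin m)) (N : ℕ) :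
    ∑ w ∈ stepPreserving J, ∑ K ∈ univ.filter (fun K : Finset (Fin m) => J ⊆ K ∧ K ⊆ ascents w),
      N.choose (Kᶜ.card + 1) = N ^ (Jᶜ.card + 1) := by
  obtain ⟨blk, hb⟩ := exists_isCollapse J
  simp only [← card_filter_chain]
  rw [← hb.image_inflate, sum_image hb.inflate_injective.injOn]
  simp only [hb.card_filter_inflate]
  rw [← card_eq_sum_card_fiberwise (fun _ _ => mem_coe.2 (mem_univ _)), card_univ, Fintype.card_fun,
    Fintype.card_fin, Fintype.card_fin]

/-- The number of step preserving permutations increasing along `K`. -/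
def stepCount {m : ℕ} (J K : Finset (Fin m)) : ℕ :=
  ((stepPreserving J).filter fun w => K ⊆ ascents w).card

lemma sum_stepCount {m : ℕ} (J : Finset (Fin m)) :
    ∑ K ∈ univ.filter (fun K : Finset (Fin m) => J ⊆ K),
      (stepCount J K : ℂ) * (binomPoly (Kᶜ.card + 1)).coeff 1 = if J = univ then 1 else 0 := by
  have key : ∑ K ∈ univ.filter (fun K : Finset (Fin m) => J ⊆ K),
      Polynomial.C (stepCount J K : ℂ) * binomPoly (Kᶜ.card + 1) =
        Polynomial.X ^ (Jᶜ.card + 1) := by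
    refine poly_ext fun N => ?_
    rw [Polynomial.eval_finsetSum, Polynomial.eval_pow, Polynomial.eval_X]
    simp only [Polynomial.eval_mul, Polynomial.eval_C, eval_binomPoly]
    rw [← Nat.cast_pow, ← sum_card_stepPreserving]
    norm_cast
    simp only [stepCount, card_filter, sum_mul, ite_mul, one_mul, zero_mul]
    rw [sum_comm]
    refine sum_congr rfl fun w _ => ?_
    rw [← sum_filter, filter_filter]
  have := congrArg (fun P => Polynomial.coeff P 1) key
  simp only [Polynomial.finsetSum_coeff, Polynomial.coeff_C_mul, Polynomial.coeff_X_pow] at this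
  rw [this]
  congr 1
  simp

lemma stp_injective {m : ℕ} : Function.Injective (stp : Fin m → Perm (Fin (m + 1))) := by
  intro i j h
  have h1 := congrArg (fun f : Perm (Fin (m + 1)) => (f i.castSucc : ℕ)) h
  simp only [stp_castSucc, Fin.val_succ] at h1
  rw [stp, swap_apply_def] at h1
  simp only [Fin.ext_iff, Fin.val_castSucc] at h1 ⊢
  split_ifs at h1 <;> (try simp only [Fin.val_castSucc, Fin.val_succ] at *) <;> omega

/-- The set of simple reflections indexed by `J`. -/
def stpSet {m : ℕ} (J : Finset (Fin m)) : Finset (Perm (Fin (m + 1))) :=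
  J.map ⟨stp, stp_injective⟩

lemma mem_stpSet {m : ℕ} {J : Finset (Fin m)} {x : Perm (Fin (m + 1))} :
    x ∈ stpSet J ↔ ∃ i ∈ J, stp i = x := by
  simp [stpSet]

lemma stpSet_univ {m : ℕ} : stpSet (univ : Finset (Fin m)) = Simples (m + 1) := by
  ext x
  simp [mem_stpSet, mem_Simples]

lemma stpSet_subset {m : ℕ} {J K : Finset (Fin m)} : stpSet J ⊆ stpSet K ↔ J ⊆ K :=
  map_subset_map

lemma mem_minCoset {m : ℕ} {K : Finset (Fin m)} {w : Perm (Fin (m + 1))} :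
    w ∈ minCoset (m + 1) Set.univ (stpSet K) ↔ K ⊆ ascents w := by
  simp only [minCoset, mem_filter, mem_univ, Set.mem_univ, true_and, mem_stpSet]
  constructor
  · intro h i hi
    exact mem_ascents.2 ((len_lt_len_mul_stp w i).1 (h _ ⟨i, hi, rfl⟩))
  · rintro h _ ⟨i, hi, rfl⟩
    exact (len_lt_len_mul_stp w i).2 (mem_ascents.1 (h hi))

lemma mC_stpSet {m : ℕ} (J K : Finset (Fin m)) :
    mC (m + 1) Set.univ (Simples (m + 1)) (stpSet J) (stpSet K) =
      if J ⊆ K then stepCount J K else 0 := by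
  simp only [mC, stpSet_subset]
  refine if_congr Iff.rfl (congrArg card ?_) rfl
  ext w
  simp only [mem_filter, mem_minCoset, mem_stepPreserving, Takes, mem_stpSet]
  rw [and_comm]
  refine and_congr_left fun _ => ?_
  constructor
  · intro h i hi
    exact (conj_mem_and_len_iff w i).1 (h _ ⟨i, hi, rfl⟩)
  · rintro h _ ⟨i, hi, rfl⟩
    exact (conj_mem_and_len_iff w i).2 (h i hi)

section BBHT

variable {m : ℕ} {e : Finset (Perm (Fin (m + 1))) → MonoidAlgebra ℂ (Perm (Fin (m + 1)))}

lemma sum_of_eq_sum_stepCount (he : IsBBHT (m + 1) Set.univ (Simples (m + 1)) e)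
    (K : Finset (Fin m)) :
    ∑ w ∈ univ.filter (fun w => K ⊆ ascents w), of ℂ (Perm (Fin (m + 1))) w =
      ∑ J : Finset (Fin m), if J ⊆ K then (stepCount J K : ℂ) • e (stpSet J) else 0 := by
  have h := he (stpSet K)
    (mem_powerset.2 (by rw [← stpSet_univ, stpSet_subset]; exact subset_univ K))
  have hx : xRel (m + 1) Set.univ (stpSet K) =
      ∑ w ∈ univ.filter (fun w => K ⊆ ascents w), of ℂ (Perm (Fin (m + 1))) w := by
    refine sum_congr ?_ fun _ _ => rfl
    ext w
    simp only [mem_minCoset, mem_filter, mem_univ, true_and]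
  rw [← hx, h, ← sum_filter]
  symm
  refine sum_bij (fun J _ => stpSet J) ?_ (fun _ _ _ _ h => map_injective _ h) ?_ ?_
  · intro J hJ
    exact mem_powerset.2 (stpSet_subset.2 (mem_filter.1 hJ).2)
  · intro L hL
    obtain ⟨J, hJ, rfl⟩ := subset_map_iff.1 (mem_powerset.1 hL)
    exact ⟨J, mem_filter.2 ⟨mem_univ J, hJ⟩, rfl⟩
  · intro J hJ
    rw [mC_stpSet, if_pos (mem_filter.1 hJ).2]

lemma top_eq_sum (he : IsBBHT (m + 1) Set.univ (Simples (m + 1)) e) :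
    e (Simples (m + 1)) =
      ∑ w, (chainPoly (ascents w)).coeff 1 • of ℂ (Perm (Fin (m + 1))) w := by
  have h1 : ∑ K : Finset (Fin m), (binomPoly (Kᶜ.card + 1)).coeff 1 •
      ∑ w ∈ univ.filter (fun w => K ⊆ ascents w), of ℂ (Perm (Fin (m + 1))) w =
      e (Simples (m + 1)) := by
    simp only [sum_of_eq_sum_stepCount he, smul_sum]
    rw [sum_comm]
    have h2 : ∀ J : Finset (Fin m), ∑ K : Finset (Fin m), (binomPoly (Kᶜ.card + 1)).coeff 1 •
        (if J ⊆ K then (stepCount J K : ℂ) • e (stpSet J) else 0) =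
        (if J = univ then (1 : ℂ) else 0) • e (stpSet J) := by
      intro J
      rw [← sum_stepCount, sum_smul, sum_filter]
      refine sum_congr rfl fun K _ => ?_
      split_ifs
      · rw [smul_smul, mul_comm]
      · rw [smul_zero]
    simp only [h2, ite_smul, one_smul, zero_smul, sum_ite_eq', mem_univ, if_true, stpSet_univ]
  rw [← h1]
  simp only [smul_sum, sum_filter, smul_ite, smul_zero]
  rw [sum_comm]
  refine sum_congr rfl fun w _ => ?_
  rw [chainPoly, Polynomial.finsetSum_coeff, sum_smul, ← sum_filter]
  refine sum_congr ?_ fun _ _ => rfl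
  ext K
  simp only [mem_filter, mem_univ, true_and, mem_powerset]

lemma top_mul_sum_valleys (he : IsBBHT (m + 1) Set.univ (Simples (m + 1)) e) {k : ℕ}
    (hk : 1 ≤ k) (hkm : k ≤ m) :
    e (Simples (m + 1)) * ∑ y ∈ valleys m (m + 1) k, of ℂ (Perm (Fin (m + 1))) y = 0 := by
  rw [top_eq_sum he, mul_sum]
  have h : ∀ y : Perm (Fin (m + 1)),
      (∑ w, (chainPoly (ascents w)).coeff 1 • of ℂ (Perm (Fin (m + 1))) w) * of ℂ _ y =
      ∑ w, (chainPoly (ascents (w * y⁻¹))).coeff 1 • of ℂ (Perm (Fin (m + 1))) w := by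
    intro y
    rw [sum_mul, ← Equiv.sum_comp (Equiv.mulRight y)
      fun w => (chainPoly (ascents (w * y⁻¹))).coeff 1 • of ℂ (Perm (Fin (m + 1))) w]
    refine sum_congr rfl fun w _ => ?_
    simp only [coe_mulRight, mul_inv_cancel_right, map_mul, smul_mul_assoc]
  simp only [h]
  rw [sum_comm]
  refine sum_eq_zero fun w _ => ?_
  rw [← sum_smul, sum_valleys_coeff_one hk hkm, zero_smul]

end BBHT

lemma cgen_one : cgen n 1 = 1 := by simp [cgen]

lemma cgen_add_two (l : ℕ) : cgen n (l + 2) = sgen n (l + 1) * cgen n (l + 1) := by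
  simp [cgen, List.range_succ]

lemma bplus_zero_left (k : ℕ) : bplus n 0 k = if k = 0 then 1 else 0 := by
  simp [bplus, Polynomial.coeff_one]

lemma bplus_succ_zero (l : ℕ) : bplus n (l + 1) 0 = bplus n l 0 := by
  simp only [bplus, List.range_succ, List.map_append, List.prod_append, List.map_singleton,
    List.prod_singleton]
  rw [mul_sub, mul_one, ← mul_assoc, Polynomial.coeff_sub, Polynomial.coeff_mul_X_zero, sub_zero]

lemma bplus_succ_succ (l k : ℕ) : bplus n (l + 1) (k + 1) =
    bplus n l (k + 1) - bplus n l k * of ℂ (Perm (Fin n)) (cgen n (l + 1)) := by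
  simp only [bplus, List.range_succ, List.map_append, List.prod_append, List.map_singleton,
    List.prod_singleton]
  rw [mul_sub, mul_one, ← mul_assoc, Polynomial.coeff_sub, Polynomial.coeff_mul_X,
    Polynomial.coeff_mul_C]

section Valleys

variable {m : ℕ}

lemma cgen_apply {j : ℕ} (hj : j ≤ m) (t : Fin (m + 1)) :
    (cgen (m + 1) (j + 1) t : ℕ) = if (t : ℕ) = 0 then j else if (t : ℕ) ≤ j then t - 1 else t := by
  induction j with
  | zero =>
    rw [cgen_one, Perm.one_apply]
    split_ifs <;> omega
  | succ j ih =>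
    have hs := sgen_succ (⟨j, hj⟩ : Fin m)
    simp only at hs
    rw [cgen_add_two, hs, Perm.mul_apply, stp, swap_apply_def]
    have := ih (by omega)
    simp only [Fin.ext_iff, Fin.val_castSucc, Fin.val_succ]
    split_ifs at * <;> (try simp only [Fin.val_castSucc, Fin.val_succ] at *) <;> omega

lemma val_lt_of_fix {l : ℕ} {y : Perm (Fin (m + 1))} (h : ∀ j : Fin (m + 1), l ≤ j → y j = j)
    (j : Fin (m + 1)) (hj : (j : ℕ) < l) : (y j : ℕ) < l := by
  by_contra hcon
  have := y.injective (h (y j) (by omega))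
  rw [this] at hcon
  exact hcon hj

lemma valleys_zero (l : ℕ) : valleys m l 0 = {1} := by
  ext y
  rw [mem_valleys, mem_singleton]
  constructor
  · rintro ⟨-, h⟩
    exact eq_one_of_forall_lt fun i => mem_ascents.1 ((h i).2 (Nat.zero_le _))
  · rintro rfl
    exact ⟨fun _ _ => rfl, fun i => ⟨fun h => absurd h (by omega),
      fun _ => mem_ascents.2 Fin.castSucc_lt_succ⟩⟩

lemma eq_one_of_mem_valleys_one {k : ℕ} {y : Perm (Fin (m + 1))} (hy : y ∈ valleys m 1 k) :
    y = 1 := by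
  rw [mem_valleys] at hy
  ext j
  by_cases hj : 1 ≤ (j : ℕ)
  · rw [hy.1 j hj, Perm.one_apply]
  · have := val_lt_of_fix hy.1 j (by omega)
    rw [Perm.one_apply]
    omega

lemma valleys_one_one : valleys m 1 1 = {1} := by
  ext y
  rw [mem_singleton]
  constructor
  · exact eq_one_of_mem_valleys_one
  · rintro rfl
    rw [mem_valleys]
    exact ⟨fun _ _ => rfl, fun i => ⟨fun h => absurd h (by omega),
      fun _ => mem_ascents.2 Fin.castSucc_lt_succ⟩⟩

lemma valleys_one_add_two {k : ℕ} (hm : 1 ≤ m) : valleys m 1 (k + 2) = ∅ := by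
  refine eq_empty_of_forall_notMem fun y hy => ?_
  obtain rfl := eq_one_of_mem_valleys_one hy
  exact ((mem_valleys.1 hy).2 ⟨0, hm⟩).1 (by simp) (mem_ascents.2 Fin.castSucc_lt_succ)

lemma filter_valleys (l k : ℕ) (hl : l ≤ m) :
    (valleys m (l + 1) k).filter (fun z => (z ⟨l, by omega⟩ : ℕ) = l) = valleys m l k := by
  ext z
  simp only [mem_filter, mem_valleys]
  constructor
  · rintro ⟨⟨h1, h2⟩, h3⟩
    refine ⟨fun j hj => ?_, h2⟩
    rcases hj.eq_or_lt with h | h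
    · subst h
      exact Fin.ext h3
    · exact h1 j h
  · rintro ⟨h1, h2⟩
    exact ⟨⟨fun j hj => h1 j (by omega), h2⟩, by rw [h1 _ le_rfl]⟩

lemma cgen_zero {l : ℕ} (hl : l ≤ m) : cgen (m + 1) (l + 1) 0 = ⟨l, by omega⟩ := by
  ext
  rw [cgen_apply hl]
  simp

lemma cgen_succ_of_lt {l : ℕ} (hl : l ≤ m) {i : Fin m} (hi : (i : ℕ) < l) :
    cgen (m + 1) (l + 1) i.succ = i.castSucc := by
  ext
  rw [cgen_apply hl, if_neg (by simp), if_pos (by simpa using hi)]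
  simp

lemma cgen_of_lt {l : ℕ} (hl : l ≤ m) {j : Fin (m + 1)} (hj : l < j) :
    cgen (m + 1) (l + 1) j = j := by
  ext
  rw [cgen_apply hl, if_neg (by omega), if_neg (by omega)]

section Fix

variable {l : ℕ} {y : Perm (Fin (m + 1))}

lemma mem_ascents_of_fix (hfix : ∀ j : Fin (m + 1), l ≤ j → y j = j) {i : Fin m}
    (hi : l ≤ (i : ℕ) + 1) : i ∈ ascents y := by
  rw [mem_ascents, hfix i.succ (by simpa using hi), Fin.lt_def]
  by_cases h : l ≤ (i : ℕ)
  · rw [hfix i.castSucc h]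
    simp
  · have := val_lt_of_fix hfix i.castSucc (by simpa using h)
    simp only [Fin.val_succ]
    omega

lemma zero_notMem_ascents_mul_cgen (hfix : ∀ j : Fin (m + 1), l ≤ j → y j = j) (hl : 1 ≤ l)
    (hlm : l ≤ m) {i : Fin m} (hi : (i : ℕ) = 0) :
    i ∉ ascents (y * cgen (m + 1) (l + 1)) := by
  have h0 : i.castSucc = 0 := Fin.ext hi
  rw [mem_ascents, Perm.mul_apply, Perm.mul_apply, cgen_succ_of_lt hlm (by omega), h0,
    cgen_zero hlm, hfix _ le_rfl, Fin.lt_def, ← h0]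
  have := val_lt_of_fix hfix i.castSucc (by simp only [Fin.val_castSucc]; omega)
  simp only
  omega

lemma mem_ascents_mul_cgen_iff (hlm : l ≤ m) {i i' : Fin m} (hi : (i : ℕ) < l)
    (hii' : (i : ℕ) = i' + 1) :
    i ∈ ascents (y * cgen (m + 1) (l + 1)) ↔ i' ∈ ascents y := by
  have h : i.castSucc = i'.succ := Fin.ext (by simpa using hii')
  rw [mem_ascents, mem_ascents, Perm.mul_apply, Perm.mul_apply, cgen_succ_of_lt hlm hi, h,
    cgen_succ_of_lt hlm (by omega)]

lemma mul_cgen_fix (hfix : ∀ j : Fin (m + 1), l ≤ j → y j = j) (hlm : l ≤ m) (j : Fin (m + 1))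
    (hj : l + 1 ≤ (j : ℕ)) :
    (y * cgen (m + 1) (l + 1)) j = j := by
  rw [Perm.mul_apply, cgen_of_lt hlm hj, hfix j (by omega)]

lemma mul_cgen_mem_valleys_iff (hfix : ∀ j : Fin (m + 1), l ≤ j → y j = j) {k : ℕ} (hl : 1 ≤ l)
    (hlm : l ≤ m) (hkm : k ≤ m) :
    y * cgen (m + 1) (l + 1) ∈ valleys m (l + 1) (k + 1) ↔ y ∈ valleys m l k := by
  rw [mem_valleys, mem_valleys]
  constructor
  · rintro ⟨-, h⟩
    have hkl : k ≤ l := by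
      by_contra! hcon
      exact (h ⟨l, by omega⟩).1 (by simpa using hcon)
        (mem_ascents_of_fix (mul_cgen_fix hfix hlm) le_rfl)
    refine ⟨hfix, fun i => ?_⟩
    by_cases hi : l ≤ (i : ℕ) + 1
    · exact ⟨fun _ => by omega, fun _ => mem_ascents_of_fix hfix hi⟩
    · have := h ⟨i + 1, by omega⟩
      rw [mem_ascents_mul_cgen_iff (i' := i) hlm (by simpa using hi) rfl] at this
      simpa using this
  · rintro ⟨-, h⟩
    refine ⟨mul_cgen_fix hfix hlm, fun i => ?_⟩
    by_cases hi0 : (i : ℕ) = 0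
    · exact ⟨fun _ => zero_notMem_ascents_mul_cgen hfix hl hlm hi0, fun _ => by omega⟩
    have h' := h ⟨i - 1, by omega⟩
    by_cases hi : (i : ℕ) < l
    · rw [mem_ascents_mul_cgen_iff (i' := ⟨i - 1, by omega⟩) hlm hi (by simp only; omega)]
      exact ⟨fun _ => h'.1 (by simp only; omega), fun _ => h'.2 (by simp only; omega)⟩
    · exact ⟨fun _ => absurd (mem_ascents_of_fix hfix (by simp only; omega))
        (h'.1 (by simp only; omega)),
        fun _ => mem_ascents_of_fix (mul_cgen_fix hfix hlm) (by omega)⟩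

end Fix

lemma apply_zero_of_mem_valleys {l k : ℕ} (hlm : l ≤ m) {z : Perm (Fin (m + 1))}
    (hz : z ∈ valleys m (l + 1) (k + 1)) (hne : (z ⟨l, by omega⟩ : ℕ) ≠ l) :
    z 0 = ⟨l, by omega⟩ := by
  rw [mem_valleys] at hz
  obtain ⟨hfix, hstep⟩ := hz
  simp only [mem_ascents] at hstep
  obtain ⟨t, ht⟩ := z.surjective ⟨l, by omega⟩
  have htl : (t : ℕ) < l := by
    rcases lt_trichotomy (t : ℕ) l with h | h | h
    · exact h
    · subst h
      exact absurd (congrArg Fin.val ht) hne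
    · have := hfix t h
      rw [ht, Fin.ext_iff] at this
      simp only at this
      omega
  have hle : ∀ j : Fin (m + 1), (j : ℕ) ≤ l → (z j : ℕ) ≤ l := fun j hj =>
    Nat.lt_succ_iff.1 (val_lt_of_fix hfix j (by omega))
  rcases Nat.eq_zero_or_pos (t : ℕ) with h0 | hpos
  · rw [← ht]
    congr 1
    exact (Fin.ext h0).symm
  · exfalso
    have h1 : (⟨t - 1, by omega⟩ : Fin m).succ = t := Fin.ext (by simp only [Fin.val_succ]; omega)
    have h2 : (⟨t, by omega⟩ : Fin m).castSucc = t := rfl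
    by_cases hk : (t : ℕ) < k + 1
    · have h3 := (hstep ⟨t - 1, by omega⟩).1 (by simp only; omega)
      have h4 := hle (⟨t - 1, by omega⟩ : Fin m).castSucc (by simp only [Fin.val_castSucc]; omega)
      rw [h1, ht, Fin.lt_def] at h3
      simp only at h3
      have h5 := z.injective (ht.trans (Fin.ext (by simp only; omega)) :
        z t = z (⟨t - 1, by omega⟩ : Fin m).castSucc)
      rw [Fin.ext_iff] at h5
      simp only [Fin.val_castSucc] at h5
      omega
    · have h3 := (hstep ⟨t, by omega⟩).2 (by simp only; omega)
      have h4 := hle (⟨t, by omega⟩ : Fin m).succ (by simp only [Fin.val_succ]; omega)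
      rw [h2, ht, Fin.lt_def] at h3
      simp only at h3
      omega

lemma sum_valleys_succ {l k : ℕ} (hl : 1 ≤ l) (hlm : l ≤ m) (hkm : k ≤ m) :
    ∑ y ∈ valleys m (l + 1) (k + 1), of ℂ (Perm (Fin (m + 1))) y =
      ∑ y ∈ valleys m l (k + 1), of ℂ (Perm (Fin (m + 1))) y +
      (∑ y ∈ valleys m l k, of ℂ (Perm (Fin (m + 1))) y) * of ℂ _ (cgen (m + 1) (l + 1)) := by
  rw [← sum_filter_add_sum_filter_not (valleys m (l + 1) (k + 1))
    fun z => (z ⟨l, by omega⟩ : ℕ) = l, filter_valleys l (k + 1) hlm, sum_mul]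
  congr 1
  symm
  refine sum_bij (fun y _ => y * cgen (m + 1) (l + 1)) ?_ (fun _ _ _ _ h => mul_right_cancel h) ?_
    fun _ _ => (map_mul _ _ _).symm
  · intro y hy
    have hfix := (mem_valleys.1 hy).1
    refine mem_filter.2 ⟨(mul_cgen_mem_valleys_iff hfix hl hlm hkm).2 hy, ?_⟩
    refine (val_lt_of_fix hfix _ ?_).ne
    rw [cgen_apply hlm]
    simp only
    split_ifs <;> omega
  · intro z hz
    obtain ⟨hz, hne⟩ := mem_filter.1 hz
    have h0 := apply_zero_of_mem_valleys hlm hz hne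
    refine ⟨z * (cgen (m + 1) (l + 1))⁻¹, ?_, inv_mul_cancel_right _ _⟩
    rw [← mul_cgen_mem_valleys_iff _ hl hlm hkm, inv_mul_cancel_right]
    · exact hz
    · intro j hj
      rcases hj.eq_or_lt with h | h
      · have hj' : j = ⟨l, by omega⟩ := Fin.ext h.symm
        rw [hj', Perm.mul_apply, Perm.inv_eq_iff_eq.2 (cgen_zero hlm).symm, h0]
      · have := (mem_valleys.1 hz).1 j h
        rw [Perm.mul_apply, Perm.inv_eq_iff_eq.2 (cgen_of_lt hlm h).symm, this]

lemma bplus_eq_sum_valleys {l k : ℕ} (hm : 1 ≤ m) (hlm : l ≤ m) (hkm : k ≤ m) :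
    bplus (m + 1) (l + 1) k =
      (-1 : ℂ) ^ k • ∑ y ∈ valleys m (l + 1) k, of ℂ (Perm (Fin (m + 1))) y := by
  induction l generalizing k with
  | zero =>
    rcases k with - | - | k
    · simp [bplus_succ_zero, bplus_zero_left, valleys_zero, MonoidAlgebra.one_def]
    · simp [bplus_succ_succ, bplus_zero_left, valleys_one_one, cgen_one]
    · simp [bplus_succ_succ, bplus_zero_left, valleys_one_add_two hm]
  | succ l ih =>
    rcases k with - | k
    · rw [bplus_succ_zero, ih (by omega) (by omega), valleys_zero, valleys_zero]
    · rw [bplus_succ_succ, ih (by omega) hkm, ih (by omega) (by omega),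
        sum_valleys_succ (by omega) hlm (by omega), smul_add, pow_succ, smul_mul_assoc, mul_smul,
        mul_smul, neg_one_smul, neg_one_smul, smul_neg, smul_neg, sub_eq_add_neg]

end Valleys

section Parabolic

variable {m : ℕ}

lemma top_mul_bplus_eq_zero {e : Finset (Perm (Fin (m + 1))) → MonoidAlgebra ℂ (Perm (Fin (m + 1)))}
    (he : IsBBHT (m + 1) Set.univ (Simples (m + 1)) e) {k : ℕ} (hk : 1 ≤ k) (hkm : k ≤ m) :
    e (Simples (m + 1)) * bplus (m + 1) (m + 1) k = 0 := by
  rw [bplus_eq_sum_valleys (hk.trans hkm) le_rfl hkm, mul_smul_comm,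
    top_mul_sum_valleys he hk hkm, smul_zero]

lemma bplus_zero_right (l : ℕ) : bplus n l 0 = 1 := by
  induction l with
  | zero => simp [bplus_zero_left]
  | succ l ih => rw [bplus_succ_zero, ih]

lemma top_mul_cgen_pow {e : Finset (Perm (Fin (m + 1))) → MonoidAlgebra ℂ (Perm (Fin (m + 1)))}
    (he : IsBBHT (m + 1) Set.univ (Simples (m + 1)) e) {k : ℕ} (hkm : k ≤ m) :
    e (Simples (m + 1)) * of ℂ (Perm (Fin (m + 1))) (cgen (m + 1) (m + 1)) ^ k =
      e (Simples (m + 1)) * bplus (m + 1) m k := by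
  induction k with
  | zero => rw [bplus_zero_right, pow_zero]
  | succ k ih =>
    have h := top_mul_bplus_eq_zero he (Nat.succ_pos k) hkm
    rw [bplus_succ_succ, mul_sub, sub_eq_zero] at h
    rw [h, pow_succ, ← mul_assoc, ← mul_assoc, ih (by omega)]

variable (m) in
/-- The parabolic subgroup generated by all simple reflections but the last one. -/
def parabolic : Subgroup (Perm (Fin (m + 1))) :=
  Subgroup.closure {x | ∃ i, 1 ≤ i ∧ i ≤ m + 1 - 2 ∧ x = sgen (m + 1) i}

lemma sgen_mem_parabolic {i : ℕ} (h : i + 1 < m) : sgen (m + 1) (i + 1) ∈ parabolic m :=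
  Subgroup.subset_closure ⟨i + 1, by omega, by omega, rfl⟩

lemma mem_parabolic {w : Perm (Fin (m + 1))} (h : w (Fin.last m) = Fin.last m) :
    w ∈ parabolic m := by
  induction hk : (invs w).card generalizing w with
  | zero =>
    have : w = 1 := by
      refine eq_one_of_forall_lt fun i => (lt_or_gt_step w i).resolve_right fun h => ?_
      have := card_invs_mul_stp_of_gt w i h
      omega
    rw [this]
    exact one_mem _
  | succ k ih =>
    obtain ⟨i, hi⟩ : ∃ i : Fin m, w i.succ < w i.castSucc := by
      by_contra! hcon
      have : w = 1 := eq_one_of_forall_lt fun i => (lt_or_gt_step w i).resolve_right (hcon i).not_gt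
      subst this
      simp [invs_one] at hk
    have hne : i.succ ≠ Fin.last m := by
      intro hl
      rw [hl, h] at hi
      exact hi.not_ge (Fin.le_last _)
    have him : (i : ℕ) + 1 < m := by
      have := Fin.val_lt_last hne
      simpa using this
    have hfix : stp i (Fin.last m) = Fin.last m :=
      swap_apply_of_ne_of_ne (Fin.castSucc_lt_last i).ne' hne.symm
    have hmem := ih (w := w * stp i) (by rw [Perm.mul_apply, hfix, h])
      (by have := card_invs_mul_stp_of_gt w i hi; omega)
    have hs := sgen_mem_parabolic him
    rw [sgen_succ i] at hs
    simpa [mul_assoc, stp_mul_stp] using mul_mem hmem hs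

lemma cgen_mem_parabolic {l : ℕ} (hl : l < m) : cgen (m + 1) (l + 1) ∈ parabolic m := by
  induction l with
  | zero =>
    rw [cgen_one]
    exact one_mem _
  | succ l ih =>
    rw [cgen_add_two]
    exact mul_mem (sgen_mem_parabolic hl) (ih (by omega))

variable (m) in
/-- The linear span of the parabolic subgroup `parabolic m` in the group algebra. -/
def parabolicSpan : Submodule ℂ (MonoidAlgebra ℂ (Perm (Fin (m + 1)))) :=
  Submodule.span ℂ (of ℂ (Perm (Fin (m + 1))) '' (parabolic m : Set (Perm (Fin (m + 1)))))

lemma of_mem_parabolicSpan {w : Perm (Fin (m + 1))} (h : w ∈ parabolic m) :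
    of ℂ (Perm (Fin (m + 1))) w ∈ parabolicSpan m :=
  Submodule.subset_span ⟨w, h, rfl⟩

lemma mul_of_mem_parabolicSpan {x : MonoidAlgebra ℂ (Perm (Fin (m + 1)))} (hx : x ∈ parabolicSpan m)
    {w : Perm (Fin (m + 1))} (h : w ∈ parabolic m) :
    x * of ℂ (Perm (Fin (m + 1))) w ∈ parabolicSpan m := by
  induction hx using Submodule.span_induction with
  | mem x hx =>
    obtain ⟨v, hv, rfl⟩ := hx
    rw [← map_mul]
    exact of_mem_parabolicSpan (mul_mem hv h)
  | zero =>
    rw [zero_mul]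
    exact zero_mem _
  | add x y _ _ ihx ihy =>
    rw [add_mul]
    exact add_mem ihx ihy
  | smul a x _ ih =>
    rw [smul_mul_assoc]
    exact Submodule.smul_mem _ a ih

lemma bplus_mem_parabolicSpan {l k : ℕ} (hl : l ≤ m) : bplus (m + 1) l k ∈ parabolicSpan m := by
  have h1 : (1 : MonoidAlgebra ℂ (Perm (Fin (m + 1)))) ∈ parabolicSpan m := by
    rw [← map_one (of ℂ (Perm (Fin (m + 1))))]
    exact of_mem_parabolicSpan (one_mem _)
  induction l generalizing k with
  | zero =>
    rw [bplus_zero_left]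
    split_ifs
    · exact h1
    · exact zero_mem _
  | succ l ih =>
    rcases k with - | k
    · rw [bplus_zero_right]
      exact h1
    · rw [bplus_succ_succ]
      exact sub_mem (ih (by omega)) (mul_of_mem_parabolicSpan (ih (by omega))
        (cgen_mem_parabolic hl))

lemma cgen_pow_apply_last {k : ℕ} (hk : k ≤ m) :
    ((cgen (m + 1) (m + 1) ^ k) (Fin.last m) : ℕ) = m - k := by
  induction k with
  | zero => simp
  | succ k ih =>
    rw [pow_succ', Perm.mul_apply, cgen_apply le_rfl, ih (by omega), if_neg (by omega),
      if_pos (by omega)]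
    omega

lemma exists_cgen_pow_mul (w : Perm (Fin (m + 1))) :
    ∃ k ≤ m, ∃ v ∈ parabolic m, w = cgen (m + 1) (m + 1) ^ k * v := by
  refine ⟨m - w (Fin.last m), by omega, (cgen (m + 1) (m + 1) ^ (m - (w (Fin.last m) : ℕ)))⁻¹ * w,
    mem_parabolic ?_, (mul_inv_cancel_left _ _).symm⟩
  rw [Perm.mul_apply, Perm.inv_eq_iff_eq]
  ext
  rw [cgen_pow_apply_last (by omega)]
  omega

lemma exists_top_mul_eq {e : Finset (Perm (Fin (m + 1))) → MonoidAlgebra ℂ (Perm (Fin (m + 1)))}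
    (he : IsBBHT (m + 1) Set.univ (Simples (m + 1)) e) (x : MonoidAlgebra ℂ (Perm (Fin (m + 1)))) :
    ∃ y ∈ parabolicSpan m, e (Simples (m + 1)) * y = e (Simples (m + 1)) * x := by
  induction x using MonoidAlgebra.induction_on with
  | of w =>
    obtain ⟨k, hk, v, hv, rfl⟩ := exists_cgen_pow_mul w
    refine ⟨bplus (m + 1) m k * of ℂ _ v,
      mul_of_mem_parabolicSpan (bplus_mem_parabolicSpan le_rfl) hv, ?_⟩
    rw [map_mul, map_pow, ← mul_assoc, ← mul_assoc, top_mul_cgen_pow he hk]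
  | add x y hx hy =>
    obtain ⟨x', hx', hx⟩ := hx
    obtain ⟨y', hy', hy⟩ := hy
    exact ⟨x' + y', add_mem hx' hy', by rw [mul_add, mul_add, hx, hy]⟩
  | smul a x hx =>
    obtain ⟨x', hx', hx⟩ := hx
    exact ⟨a • x', Submodule.smul_mem _ a hx', by rw [mul_smul_comm, mul_smul_comm, hx]⟩

end Parabolic

/-- Proposition 5.4(b): with `c = c_n` the `n`-cycle `s_{n-1} ⋯ s_2 s_1` and
`e_n = e_S` the top BBHT quasi-idempotent, `e_n c^k = e_n b⁺(n-1, k)` for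
`0 ≤ k ≤ n-1`; in particular `E_n = e_n ℂW = e_n ℂW_{n-1}`, where
`W_{n-1} = ⟨s_1, …, s_{n-2}⟩`. -/
theorem stmt12 (hn : 2 ≤ n)
    (e : Finset (Equiv.Perm (Fin n)) → MonoidAlgebra ℂ (Equiv.Perm (Fin n)))
    (he : IsBBHT n Set.univ (Simples n) e) :
    (∀ k ≤ n - 1,
      e (Simples n) * (of ℂ (Equiv.Perm (Fin n)) (cgen n n)) ^ k
        = e (Simples n) * bplus n (n - 1) k) ∧
    (Set.range (fun x => e (Simples n) * x)
      = (fun y => e (Simples n) * y) ''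
          ((Submodule.span ℂ (of ℂ (Equiv.Perm (Fin n)) ''
            ((Subgroup.closure {x | ∃ i, 1 ≤ i ∧ i ≤ n - 2 ∧ x = sgen n i} :
              Subgroup (Equiv.Perm (Fin n))) : Set (Equiv.Perm (Fin n)))) :
            Submodule ℂ (MonoidAlgebra ℂ (Equiv.Perm (Fin n)))) :
            Set (MonoidAlgebra ℂ (Equiv.Perm (Fin n))))) := by
  obtain ⟨m, rfl⟩ : ∃ m, n = m + 1 := ⟨n - 1, by omega⟩
  refine ⟨fun k hk => top_mul_cgen_pow he hk, Set.eq_of_subset_of_subset ?_ ?_⟩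
  · rintro _ ⟨x, rfl⟩
    exact exists_top_mul_eq he x
  · rintro _ ⟨y, -, rfl⟩
    exact ⟨y, rfl⟩

end DPRSym
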